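/- Let 𝒳 be a nonempty finite set, P_𝒳 a probability measure on 𝒳, P_ℱ a probability measure on the set of functions 𝒳 → {−1,1}, and d ≥ 1. Let D_⋆ = P_𝒳 ⊗ Unif{−1,1} on 𝒳 × {−1,1}, and for a function f : 𝒳 → {−1,1} let D_f be the law of (X, f(X)) with X ∼ P_𝒳. Then for every g : 𝒳 × {−1,1} → ℝ^d, E_{F∼P_ℱ}[ ‖E_{Z∼D_F}[g(Z)] − E_{Z∼D_⋆}[g(Z)]‖₂ ] ≤ (E_{Z∼D_⋆}[‖g(Z)‖₂²])^{1/2} · (CP(P_𝒳, P_ℱ))^{1/4}. -/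

import Mathlib

open Finset

/-- Cross-predictability of a distribution `pF` on sign-valued functions with respect to an
input distribution `pX` on a finite set `𝒳`. Signs are encoded as `ℤˣ = {±1}`. -/
noncomputable def cp {𝒳 : Type*} [Fintype 𝒳] [DecidableEq 𝒳] (pX : 𝒳 → ℝ)
    (pF : (𝒳 → ℤˣ) → ℝ) : ℝ :=
  ∑ F : 𝒳 → ℤˣ, ∑ F' : 𝒳 → ℤˣ, pF F * pF F' *
    (∑ x : 𝒳, pX x * (((F x : ℤ) : ℝ) * ((F' x : ℤ) : ℝ))) ^ 2

theorem weighted_cauchy_schwarz {ι : Type*} (s : Finset ι) (p a b : ι → ℝ)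
    (hp : ∀ i, 0 ≤ p i) :
    (∑ i ∈ s, p i * (a i * b i)) ^ 2 ≤ (∑ i ∈ s, p i * a i ^ 2) * ∑ i ∈ s, p i * b i ^ 2 :=
  Finset.sum_sq_le_sum_mul_sum_of_sq_le_mul s
    (fun i _ => mul_nonneg (hp i) (sq_nonneg _)) (fun i _ => mul_nonneg (hp i) (sq_nonneg _))
    (fun i _ => le_of_eq (by ring))

theorem weighted_sum_inner_sq_le {ι E : Type*} [NormedAddCommGroup E] [InnerProductSpace ℝ E]
    (s : Finset ι) (p : ι → ℝ) (a b : ι → E) (hp : ∀ i, 0 ≤ p i) :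
    (∑ i ∈ s, p i * inner ℝ (a i) (b i)) ^ 2 ≤
      (∑ i ∈ s, p i * ‖a i‖ ^ 2) * ∑ i ∈ s, p i * ‖b i‖ ^ 2 := by
  refine le_trans ?_ (weighted_cauchy_schwarz s p (fun i => ‖a i‖) (fun i => ‖b i‖) hp)
  rw [sq_le_sq]
  refine le_trans (Finset.abs_sum_le_sum_abs _ _) (le_trans (Finset.sum_le_sum fun i _ => ?_)
    (le_abs_self _))
  rw [abs_mul, abs_of_nonneg (hp i)]
  exact mul_le_mul_of_nonneg_left (abs_real_inner_le_norm _ _) (hp i)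

/-- The mean squared norm of the correlations of a vector field `h` with a random real-valued
function `φ i`, `i ∼ q`, is controlled by the second moment of the overlaps of the `φ i`. -/
theorem sum_norm_sq_correlation_sq_le {ι κ E : Type*} [Fintype ι] [Fintype κ]
    [NormedAddCommGroup E] [InnerProductSpace ℝ E]
    (p : κ → ℝ) (hp : ∀ x, 0 ≤ p x) (q : ι → ℝ) (hq : ∀ i, 0 ≤ q i)
    (φ : ι → κ → ℝ) (h : κ → E) :
    (∑ i, q i * ‖∑ x, p x • φ i x • h x‖ ^ 2) ^ 2 ≤
      (∑ x, p x * ‖h x‖ ^ 2) ^ 2 *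
        ∑ i, ∑ j, q i * q j * (∑ x, p x * (φ i x * φ j x)) ^ 2 := by
  set v : ι → E := fun i => ∑ x, p x • φ i x • h x with hv
  set w : κ → E := fun x => ∑ i, q i • φ i x • v i with hw
  set S := ∑ i, q i * ‖v i‖ ^ 2 with hS
  set H := ∑ x, p x * ‖h x‖ ^ 2
  set C := ∑ i, ∑ j, q i * q j * (∑ x, p x * (φ i x * φ j x)) ^ 2
  set T := ∑ x, p x * ‖w x‖ ^ 2 with hT
  have hS0 : 0 ≤ S := Finset.sum_nonneg fun i _ => mul_nonneg (hq i) (sq_nonneg _)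
  have hH0 : 0 ≤ H := Finset.sum_nonneg fun i _ => mul_nonneg (hp i) (sq_nonneg _)
  have hC0 : 0 ≤ C := Finset.sum_nonneg fun i _ => Finset.sum_nonneg fun j _ =>
    mul_nonneg (mul_nonneg (hq i) (hq j)) (sq_nonneg _)
  have hT0 : 0 ≤ T := Finset.sum_nonneg fun i _ => mul_nonneg (hp i) (sq_nonneg _)
  have S_eq : S = ∑ x, p x * inner ℝ (h x) (w x) := by
    have key : ∀ i, q i * ‖v i‖ ^ 2 = ∑ x, p x * (q i * (φ i x * inner ℝ (h x) (v i))) := by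
      intro i
      rw [← real_inner_self_eq_norm_sq]
      conv_lhs => enter [2, 2]; rw [hv]
      simp only [sum_inner, real_inner_smul_left, Finset.mul_sum]
      exact Finset.sum_congr rfl fun x _ => by ring
    rw [hS, Finset.sum_congr rfl fun i _ => key i, Finset.sum_comm]
    simp only [hw, inner_sum, real_inner_smul_right, Finset.mul_sum]
  have T_eq : T = ∑ k : ι × ι, (q k.1 * q k.2) *
      (inner ℝ (v k.1) (v k.2) * ∑ x, p x * (φ k.1 x * φ k.2 x)) := by
    have key : ∀ x, p x * ‖w x‖ ^ 2 = ∑ k : ι × ι, (q k.1 * q k.2) *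
        (inner ℝ (v k.1) (v k.2) * (p x * (φ k.1 x * φ k.2 x))) := by
      intro x
      rw [← real_inner_self_eq_norm_sq, Fintype.sum_prod_type]
      simp only [hw, sum_inner, inner_sum, real_inner_smul_left, real_inner_smul_right,
        Finset.mul_sum]
      exact Finset.sum_congr rfl fun i _ => Finset.sum_congr rfl fun j _ => by
        rw [real_inner_comm]; ring
    rw [hT, Finset.sum_congr rfl fun x _ => key x, Finset.sum_comm]
    simp only [Finset.mul_sum]
  have hST : S ^ 2 ≤ H * T := by
    rw [S_eq]
    exact weighted_sum_inner_sq_le _ p h w hp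
  have hTC : T ^ 2 ≤ S ^ 2 * C := by
    rw [T_eq]
    refine (weighted_cauchy_schwarz _ _ _ _ fun k : ι × ι => mul_nonneg (hq k.1) (hq k.2)).trans ?_
    rw [Fintype.sum_prod_type, Fintype.sum_prod_type]
    refine mul_le_mul_of_nonneg_right ?_ hC0
    rw [sq S, hS, Finset.sum_mul_sum]
    refine Finset.sum_le_sum fun i _ => Finset.sum_le_sum fun j _ => ?_
    have hij : (inner ℝ (v i) (v j)) ^ 2 ≤ (‖v i‖ * ‖v j‖) ^ 2 := by
      rw [sq_le_sq]
      exact (abs_real_inner_le_norm _ _).trans (le_abs_self _)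
    calc q i * q j * (inner ℝ (v i) (v j)) ^ 2 ≤ q i * q j * (‖v i‖ * ‖v j‖) ^ 2 :=
          mul_le_mul_of_nonneg_left hij (mul_nonneg (hq i) (hq j))
      _ = _ := by ring
  rcases hS0.eq_or_lt with h0 | h0
  · rw [← h0]
    have := mul_nonneg (sq_nonneg H) hC0
    simpa using this
  · have h1 : S ^ 2 * S ^ 2 ≤ S ^ 2 * (H ^ 2 * C) := by
      calc S ^ 2 * S ^ 2 ≤ (H * T) * (H * T) :=
            mul_le_mul hST hST (sq_nonneg _) (mul_nonneg hH0 hT0)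
        _ = H ^ 2 * T ^ 2 := by ring
        _ ≤ H ^ 2 * (S ^ 2 * C) := mul_le_mul_of_nonneg_left hTC (sq_nonneg _)
        _ = _ := by ring
    exact le_of_mul_le_mul_left h1 (pow_pos h0 2)

theorem norm_half_sub_sq_le {E : Type*} [NormedAddCommGroup E] [InnerProductSpace ℝ E] (a b : E) :
    ‖(2 : ℝ)⁻¹ • (a - b)‖ ^ 2 ≤ (‖a‖ ^ 2 + ‖b‖ ^ 2) / 2 := by
  have h := parallelogram_law_with_norm ℝ a b
  rw [norm_smul, mul_pow, Real.norm_of_nonneg (by norm_num)]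
  nlinarith [sq_nonneg ‖a + b‖]

/-- with `D_⋆ = P_𝒳 ⊗ Unif{±1}` and `D_f` the law of `(X, f(X))`,
for every `g : 𝒳 × {±1} → ℝ^d` (with the Euclidean norm):
`E_F[‖E_{D_F}[g] − E_{D_⋆}[g]‖₂] ≤ (E_{D_⋆}[‖g‖₂²])^{1/2} · CP(P_𝒳,P_ℱ)^{1/4}`. -/
theorem junk_vs_true_gradient_bound {𝒳 : Type*} [Fintype 𝒳] [DecidableEq 𝒳] [Nonempty 𝒳]
    (pX : 𝒳 → ℝ) (hpX0 : ∀ x, 0 ≤ pX x) (hpX1 : ∑ x : 𝒳, pX x = 1)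
    (pF : (𝒳 → ℤˣ) → ℝ) (hpF0 : ∀ F, 0 ≤ pF F) (hpF1 : ∑ F : 𝒳 → ℤˣ, pF F = 1)
    (d : ℕ) (hd : 1 ≤ d) (g : 𝒳 × ℤˣ → EuclideanSpace ℝ (Fin d)) :
    ∑ F : 𝒳 → ℤˣ, pF F *
        ‖(∑ x : 𝒳, pX x • g (x, F x))
          - ∑ x : 𝒳, pX x • ((2 : ℝ)⁻¹ • (g (x, 1) + g (x, -1)))‖
      ≤ Real.sqrt (∑ x : 𝒳, pX x * ((‖g (x, 1)‖ ^ 2 + ‖g (x, -1)‖ ^ 2) / 2)) *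
          cp pX pF ^ ((1 : ℝ) / 4) := by
  set h : 𝒳 → EuclideanSpace ℝ (Fin d) := fun x => (2 : ℝ)⁻¹ • (g (x, 1) - g (x, -1)) with hh
  set φ : (𝒳 → ℤˣ) → 𝒳 → ℝ := fun F x => ((F x : ℤ) : ℝ) with hφ
  have hdiff : ∀ F : 𝒳 → ℤˣ, (∑ x : 𝒳, pX x • g (x, F x))
      - ∑ x : 𝒳, pX x • ((2 : ℝ)⁻¹ • (g (x, 1) + g (x, -1))) =
        ∑ x, pX x • φ F x • h x := by
    intro F
    rw [← Finset.sum_sub_distrib]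
    refine Finset.sum_congr rfl fun x _ => ?_
    rw [← smul_sub]
    congr 1
    rcases Int.units_eq_one_or (F x) with hF | hF <;> simp only [hφ, hh, hF] <;> push_cast <;>
      module
  simp only [hdiff]
  set G := ∑ x : 𝒳, pX x * ((‖g (x, 1)‖ ^ 2 + ‖g (x, -1)‖ ^ 2) / 2)
  set L := ∑ F, pF F * ‖∑ x, pX x • φ F x • h x‖
  have hC0 : 0 ≤ cp pX pF := Finset.sum_nonneg fun F _ => Finset.sum_nonneg fun F' _ =>
    mul_nonneg (mul_nonneg (hpF0 F) (hpF0 F')) (sq_nonneg _)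
  have hG0 : 0 ≤ G := Finset.sum_nonneg fun x _ => mul_nonneg (hpX0 x) (by positivity)
  have hHG : ∑ x, pX x * ‖h x‖ ^ 2 ≤ G := Finset.sum_le_sum fun x _ =>
    mul_le_mul_of_nonneg_left (norm_half_sub_sq_le _ _) (hpX0 x)
  have hH0 : 0 ≤ ∑ x, pX x * ‖h x‖ ^ 2 :=
    Finset.sum_nonneg fun x _ => mul_nonneg (hpX0 x) (sq_nonneg _)
  have hL : L ^ 2 ≤ ∑ F, pF F * ‖∑ x, pX x • φ F x • h x‖ ^ 2 := by
    simpa [hpF1] using weighted_cauchy_schwarz Finset.univ pF (fun _ => 1)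
      (fun F => ‖∑ x, pX x • φ F x • h x‖) hpF0
  have hL4 : L ^ 4 ≤ G ^ 2 * cp pX pF := by
    calc L ^ 4 = (L ^ 2) ^ 2 := by ring
      _ ≤ (∑ F, pF F * ‖∑ x, pX x • φ F x • h x‖ ^ 2) ^ 2 :=
          pow_le_pow_left₀ (sq_nonneg _) hL 2
      _ ≤ (∑ x, pX x * ‖h x‖ ^ 2) ^ 2 * cp pX pF :=
          sum_norm_sq_correlation_sq_le pX hpX0 pF hpF0 φ h
      _ ≤ G ^ 2 * cp pX pF :=
          mul_le_mul_of_nonneg_right (pow_le_pow_left₀ hH0 hHG 2) hC0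
  refine le_of_pow_le_pow_left₀ (n := 4) (by norm_num) (by positivity) (hL4.trans_eq ?_)
  have hsqrt : √G ^ 4 = G ^ 2 := by
    rw [show 4 = 2 * 2 from rfl, pow_mul, Real.sq_sqrt hG0]
  have hroot : (cp pX pF ^ ((1 : ℝ) / 4)) ^ 4 = cp pX pF := by
    rw [← Real.rpow_natCast, ← Real.rpow_mul hC0]
    norm_num
  rw [mul_pow, hsqrt, hroot]
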